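/- Let Ω ⊆ ℝ^N be open and let u ∈ 𝒦(Ω). Then [|u|]_s² ≤ [u]_s², i.e., ∫_{ℝ^N}∫_{ℝ^N} (|u(x)|−|u(y)|)²/|x−y|^{N+2s} dx dy ≤ ∫_{ℝ^N}∫_{ℝ^N} (u(x)−u(y))²/|x−y|^{N+2s} dx dy, and the inequality is strict unless u ≥ 0 a.e. in Ω or u ≤ 0 a.e. in Ω. -/

import Mathlib

open MeasureTheory Filter Topology
open scoped ENNReal RealInnerProductSpace

noncomputable section

abbrev Euc (N : ℕ) := EuclideanSpace ℝ (Fin N)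

/-- Gagliardo energy `[u]_s²`. -/
def gagliardo (N : ℕ) (s : ℝ) (u : Euc N → ℝ) : ℝ≥0∞ :=
  ∫⁻ x : Euc N, ∫⁻ y : Euc N, ENNReal.ofReal ((u x - u y) ^ 2 / ‖x - y‖ ^ ((N : ℝ) + 2 * s))

/-- membership in the concrete model of `𝒟^{s,2}_0(Ω)`. -/
def memK (N : ℕ) (s : ℝ) (Ω : Set (Euc N)) (u : Euc N → ℝ) : Prop :=
  Measurable u ∧ (∀ᵐ x : Euc N ∂volume, x ∉ Ω → u x = 0) ∧ gagliardo N s u < ⊤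

/-- first `q`-semilinear `s`-eigenvalue. -/
def lambda1 (N : ℕ) (s q : ℝ) (Ω : Set (Euc N)) : ℝ≥0∞ :=
  ⨅ u ∈ {u : Euc N → ℝ | memK N s Ω u ∧ (∫ x in Ω, |u x| ^ q) = 1}, gagliardo N s u

/-- nonlocal bilinear form. -/
def dform (N : ℕ) (s : ℝ) (u φ : Euc N → ℝ) : ℝ :=
  ∫ p : Euc N × Euc N, (u p.1 - u p.2) * (φ p.1 - φ p.2) / ‖p.1 - p.2‖ ^ ((N : ℝ) + 2 * s)

/-- compactness of the embedding `𝒦(Ω) ↪ L^q(Ω)`. -/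
def compactEmbed (N : ℕ) (s q : ℝ) (Ω : Set (Euc N)) : Prop :=
  ∀ u : ℕ → Euc N → ℝ, (∀ n, memK N s Ω (u n)) →
    (∃ C : ℝ≥0∞, C < ⊤ ∧ ∀ n, gagliardo N s (u n) ≤ C) →
    ∃ (σ : ℕ → ℕ) (v : Euc N → ℝ), StrictMono σ ∧
      Tendsto (fun k => ∫ x in Ω, |u (σ k) x - v x| ^ q) atTop (𝓝 0)

/-- `q`-semilinear `s`-eigenfunction with eigenvalue `lam`. -/
def isEigenfunction (N : ℕ) (s q : ℝ) (Ω : Set (Euc N)) (lam : ℝ) (u : Euc N → ℝ) : Prop :=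
  memK N s Ω u ∧ 0 < ∫ x in Ω, |u x| ^ q ∧
  ∀ φ : Euc N → ℝ, memK N s Ω φ →
    dform N s u φ
      = lam * (∫ x in Ω, |u x| ^ q) ^ ((2 - q) / q) * ∫ x in Ω, |u x| ^ (q - 2) * u x * φ x

/-- `q`-semilinear `s`-eigenvalue. -/
def isEigenvalue (N : ℕ) (s q : ℝ) (Ω : Set (Euc N)) (lam : ℝ) : Prop :=
  0 < lam ∧ ∃ u : Euc N → ℝ, isEigenfunction N s q Ω lam u

/-- free energy functional `J_Ω`. -/
def freeEnergy (N : ℕ) (s q : ℝ) (Ω : Set (Euc N)) (φ : Euc N → ℝ) : ℝ :=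
  (1 / 2) * (gagliardo N s φ).toReal - (1 / q) * ∫ x in Ω, φ x ^ q

/-- Lane–Emden density of `Ω`: minimizer of the free energy among nonnegative members of `𝒦(Ω)`. -/
def isLaneEmden (N : ℕ) (s q : ℝ) (Ω : Set (Euc N)) (w : Euc N → ℝ) : Prop :=
  memK N s Ω w ∧ (∀ᵐ x : Euc N ∂volume, 0 ≤ w x) ∧
  ∀ φ : Euc N → ℝ, memK N s Ω φ → (∀ᵐ x : Euc N ∂volume, 0 ≤ φ x) →
    freeEnergy N s q Ω w ≤ freeEnergy N s q Ω φ

/-- weak solution of the fractional Lane–Emden equation in `Ω`. -/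
def isWeakSolutionLE (N : ℕ) (s q : ℝ) (Ω : Set (Euc N)) (u : Euc N → ℝ) : Prop :=
  memK N s Ω u ∧ ∀ φ : Euc N → ℝ, memK N s Ω φ →
    dform N s u φ = ∫ x in Ω, |u x| ^ (q - 2) * u x * φ x

/-- nonlocal tail. -/
def nlTail (N : ℕ) (s : ℝ) (w : Euc N → ℝ) (x₀ : Euc N) (ρ : ℝ) : ℝ :=
  ρ ^ (2 * s) * ∫ x in (Metric.ball x₀ ρ)ᶜ, |w x| / ‖x - x₀‖ ^ ((N : ℝ) + 2 * s)

/-- Integrand of the Gagliardo energy. -/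
def gagliardoDensity (N : ℕ) (s : ℝ) (u : Euc N → ℝ) (x y : Euc N) : ℝ≥0∞ :=
  ENNReal.ofReal ((u x - u y) ^ 2 / ‖x - y‖ ^ ((N : ℝ) + 2 * s))

theorem sq_abs_sub_abs_le (a b : ℝ) : (|a| - |b|) ^ 2 ≤ (a - b) ^ 2 :=
  sq_le_sq.2 (abs_abs_sub_abs_le a b)

theorem sq_abs_sub_abs_lt {a b : ℝ} (ha : a < 0) (hb : 0 < b) :
    (|a| - |b|) ^ 2 < (a - b) ^ 2 := by
  rw [abs_of_neg ha, abs_of_pos hb]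
  nlinarith [mul_pos (neg_pos.2 ha) hb]

theorem gagliardoDensity_abs_le (N : ℕ) (s : ℝ) (u : Euc N → ℝ) (x y : Euc N) :
    gagliardoDensity N s (fun z => |u z|) x y ≤ gagliardoDensity N s u x y :=
  ENNReal.ofReal_le_ofReal <|
    div_le_div_of_nonneg_right (sq_abs_sub_abs_le _ _) (by positivity)

theorem gagliardoDensity_abs_lt {N : ℕ} {s : ℝ} {u : Euc N → ℝ} {x y : Euc N}
    (hx : u x < 0) (hy : 0 < u y) :
    gagliardoDensity N s (fun z => |u z|) x y < gagliardoDensity N s u x y := by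
  have hxy : x ≠ y := by
    rintro rfl
    exact lt_asymm hx hy
  have hk : 0 < ‖x - y‖ ^ ((N : ℝ) + 2 * s) :=
    Real.rpow_pos_of_pos (norm_pos_iff.2 (sub_ne_zero.2 hxy)) _
  have hux : 0 < (u x - u y) ^ 2 := by nlinarith
  exact (ENNReal.ofReal_lt_ofReal_iff (div_pos hux hk)).2
    (div_lt_div_of_pos_right (sq_abs_sub_abs_lt hx hy) hk)

theorem measurable_gagliardoDensity {N : ℕ} (s : ℝ) {u : Euc N → ℝ} (hu : Measurable u) :
    Measurable (Function.uncurry (gagliardoDensity N s u)) := by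
  unfold gagliardoDensity Function.uncurry
  fun_prop

theorem gagliardo_abs_le (N : ℕ) (s : ℝ) (u : Euc N → ℝ) :
    gagliardo N s (fun x => |u x|) ≤ gagliardo N s u :=
  lintegral_mono fun x => lintegral_mono fun y => gagliardoDensity_abs_le N s u x y

theorem gagliardo_abs_lt {N : ℕ} {s : ℝ} {u : Euc N → ℝ} (hu : Measurable u)
    (hfin : gagliardo N s u < ⊤) (hneg : ∃ᵐ x ∂volume, u x < 0) (hpos : ∃ᵐ x ∂volume, 0 < u x) :
    gagliardo N s (fun x => |u x|) < gagliardo N s u := by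
  have hm := measurable_gagliardoDensity s hu
  have hm' : Measurable fun x => ∫⁻ y, gagliardoDensity N s u x y := hm.lintegral_prod_right'
  have hinner : ∀ᵐ x ∂volume, ∫⁻ y, gagliardoDensity N s u x y < ⊤ :=
    ae_lt_top hm' hfin.ne
  refine lintegral_strict_mono_of_ae_le_of_frequently_ae_lt hm'.aemeasurable
    ((gagliardo_abs_le N s u).trans_lt hfin).ne
    (ae_of_all _ fun x => lintegral_mono fun y => gagliardoDensity_abs_le N s u x y)
    ((hneg.and_eventually hinner).mono ?_)
  rintro x ⟨hx, hxfin⟩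
  refine (lintegral_strict_mono_of_ae_le_of_frequently_ae_lt
    (hm.comp measurable_prodMk_left).aemeasurable
    ((lintegral_mono fun y => gagliardoDensity_abs_le N s u x y).trans_lt hxfin).ne
    (ae_of_all _ fun y => gagliardoDensity_abs_le N s u x y)
    (hpos.mono fun y hy => (gagliardoDensity_abs_lt hx hy).ne)).ne

/-- the Gagliardo energy does not increase when passing to the absolute value,
with strict inequality unless `u` has a.e. constant sign in `Ω`. -/
theorem stmt_18 (N : ℕ) (hN : 1 ≤ N) (s : ℝ) (hs : s ∈ Set.Ioo (0 : ℝ) 1)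
    (Ω : Set (Euc N)) (hΩ : IsOpen Ω)
    (u : Euc N → ℝ) (hu : memK N s Ω u) :
    gagliardo N s (fun x => |u x|) ≤ gagliardo N s u ∧
    (¬ ((∀ᵐ x ∂volume.restrict Ω, 0 ≤ u x) ∨ (∀ᵐ x ∂volume.restrict Ω, u x ≤ 0)) →
      gagliardo N s (fun x => |u x|) < gagliardo N s u) := by
  refine ⟨gagliardo_abs_le N s u, fun h => ?_⟩
  push Not at h
  exact gagliardo_abs_lt hu.1 hu.2.2
    (h.1.filter_mono (ae_mono Measure.restrict_le_self))
    (h.2.filter_mono (ae_mono Measure.restrict_le_self))
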